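/- Let r ∈ ℕ, let k be an integer with 1 ≤ k ≤ r/2, and let 𝓕 = (F_1,…,F_k) be a family of at most k nonempty subsets of [r]. Then every vertex u of P_𝓕 has degree at most k(r − k), i.e. the number of vertices v such that [u,v] is an edge of P_𝓕 is at most k(r − k). -/

import Mathlib

open Pointwise

/-- The standard basis vector `e i` in `ℝ^r`. -/
noncomputable def eVec (r : ℕ) (i : Fin r) : Fin r → ℝ := Pi.single i 1

/-- The standard simplex `Δ_F ⊆ ℝ^r` supported on a subset `F` of the coordinates. -/
def simpl {r : ℕ} (F : Finset (Fin r)) : Set (Fin r → ℝ) :=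
  {x | (∀ i, 0 ≤ x i) ∧ (∀ i, i ∉ F → x i = 0) ∧ ∑ i, x i = 1}

/-- The Minkowski sum `P_𝓕 = Δ_{F 0} + ⋯ + Δ_{F (k-1)}`. -/
noncomputable def mink {r k : ℕ} (F : Fin k → Finset (Fin r)) : Set (Fin r → ℝ) :=
  ∑ j : Fin k, simpl (F j)

/-- `[u,v]` is an edge of `P`: `u ≠ v` are vertices (extreme points) of `P` and the
segment `[u,v]` is an extreme subset (face) of `P`. -/
def IsEdgeOf {r : ℕ} (P : Set (Fin r → ℝ)) (u v : Fin r → ℝ) : Prop :=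
  u ≠ v ∧ u ∈ Set.extremePoints ℝ P ∧ v ∈ Set.extremePoints ℝ P ∧
    IsExtreme ℝ P (segment ℝ u v)

/-- The degree of a vertex `u` of `P`: the number of `v` with `[u,v]` an edge of `P`. -/
noncomputable def polyDeg {r : ℕ} (P : Set (Fin r → ℝ)) (u : Fin r → ℝ) : ℕ :=
  {v | IsEdgeOf P u v}.ncard

/-- The number of edges of `P`, counted as segments. -/
noncomputable def numEdgesOf {r : ℕ} (P : Set (Fin r → ℝ)) : ℕ :=
  {s : Set (Fin r → ℝ) | ∃ u v, IsEdgeOf P u v ∧ s = segment ℝ u v}.ncard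

/-- The point `u(f) = e_{f 0} + ⋯ + e_{f (k-1)}` associated to a rep-function `f`. -/
noncomputable def urep {r k : ℕ} (f : Fin k → Fin r) : Fin r → ℝ :=
  ∑ j, eVec r (f j)

/-- A Mantel-type bound: an acyclically oriented triangle-free graph whose edges all start
in `A` has at most `|A| * |B|` edges, if `|A| ≤ |B|`. -/
lemma edges_le_mul {α : Type*} [DecidableEq α] (B : Finset α) (n : ℕ) :
    ∀ (A : Finset α) (E : Finset (α × α)), A.card ≤ n → Disjoint A B → A.card ≤ B.card →
      E ⊆ A ×ˢ (A ∪ B) →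
      (∀ x y, (x, y) ∈ E → (y, x) ∉ E) →
      (∀ x y z, (x, y) ∈ E → (y, z) ∈ E → (x, z) ∉ E) →
      (∀ x y z, (x, y) ∈ E → (y, z) ∈ E → (z, x) ∉ E) →
      E.card ≤ A.card * B.card := by
  induction n with
  | zero =>
    intro A E hA _ _ hE _ _ _
    have hA0 : A = ∅ := by simpa using hA
    subst hA0
    have : E = ∅ := by simpa using hE
    simp [this]
  | succ n ih =>
    intro A E hA hd hAB hE h2 h3 h4
    by_cases hin : ∃ a a', (a, a') ∈ E ∧ a' ∈ A
    · obtain ⟨a, a', he, ha'⟩ := hin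
      have ha : a ∈ A := (Finset.mem_product.1 (hE he)).1
      have hne : a ≠ a' := by
        rintro rfl
        exact h2 _ _ he he
      set T := E.filter (fun p => p.1 = a ∨ p.1 = a' ∨ p.2 = a ∨ p.2 = a') with hT
      set E' := E.filter (fun p => ¬ (p.1 = a ∨ p.1 = a' ∨ p.2 = a ∨ p.2 = a')) with hE'
      have hsum : T.card + E'.card = E.card := Finset.card_filter_add_card_filter_not _
      have hcA : ((A.erase a).erase a').card = A.card - 2 := by
        rw [Finset.card_erase_of_mem (Finset.mem_erase.2 ⟨hne.symm, ha'⟩),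
          Finset.card_erase_of_mem ha]
        omega
      have hA2 : 2 ≤ A.card := by
        have : ({a, a'} : Finset α) ⊆ A := by
          intro x hx
          simp only [Finset.mem_insert, Finset.mem_singleton] at hx
          rcases hx with rfl | rfl <;> assumption
        have h := Finset.card_le_card this
        rwa [Finset.card_pair hne] at h
      have hrec : E'.card ≤ (A.card - 2) * B.card := by
        rw [← hcA]
        refine ih _ _ (by omega) ?_ (by omega) ?_ ?_ ?_ ?_
        · exact Finset.disjoint_of_subset_left
            ((Finset.erase_subset _ _).trans (Finset.erase_subset _ _)) hd
        · intro p hp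
          rw [hE', Finset.mem_filter] at hp
          have := Finset.mem_product.1 (hE hp.1)
          simp only [Finset.mem_product, Finset.mem_union, Finset.mem_erase] at this ⊢
          tauto
        · intro x y hxy hyx
          exact h2 x y (Finset.mem_filter.1 hxy).1 (Finset.mem_filter.1 hyx).1
        · intro x y z hxy hyz hxz
          exact h3 x y z (Finset.mem_filter.1 hxy).1 (Finset.mem_filter.1 hyz).1
            (Finset.mem_filter.1 hxz).1
        · intro x y z hxy hyz hxz
          exact h4 x y z (Finset.mem_filter.1 hxy).1 (Finset.mem_filter.1 hyz).1
            (Finset.mem_filter.1 hxz).1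
      have haT : (a, a') ∈ T := by simp [hT, he]
      have hTc : (T.erase (a, a')).card ≤ (((A ∪ B).erase a).erase a').card := by
        refine Finset.card_le_card_of_injOn
          (fun p => if p.1 = a ∨ p.1 = a' then p.2 else p.1) ?_ ?_
        · rintro ⟨x, y⟩ hp
          have hp' := Finset.mem_erase.1 (Finset.mem_coe.1 hp)
          have hp2 := Finset.mem_filter.1 hp'.2
          have hp3 := Finset.mem_product.1 (hE hp2.1)
          have hxx := h2 x y hp2.1
          simp only [Finset.coe_erase]
          grind
        · rintro ⟨x, y⟩ hp ⟨z, w⟩ hq hpq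
          have hp' := Finset.mem_erase.1 (Finset.mem_coe.1 hp)
          have hp2 := Finset.mem_filter.1 hp'.2
          have hq' := Finset.mem_erase.1 (Finset.mem_coe.1 hq)
          have hq2 := Finset.mem_filter.1 hq'.2
          have a1 := hp2.1
          have a2 := hq2.1
          have b1 := hp2.2
          have b2 := hq2.2
          have c1 := hp'.1
          have c2 := hq'.1
          clear hp hq hp' hp2 hq' hq2 hrec hsum
          simp only at b1 b2 hpq
          grind
      rw [Finset.card_erase_of_mem haT, Finset.card_erase_of_mem, Finset.card_erase_of_mem,
        Finset.card_union_of_disjoint hd] at hTc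
      · obtain ⟨m, hm⟩ := Nat.exists_eq_add_of_le hA2
        rw [hm] at hrec hTc hAB ⊢
        have : 2 + m - 2 = m := by omega
        rw [this] at hrec
        have h5 : (2 + m) * B.card = 2 * B.card + m * B.card := by ring
        rw [h5]
        omega
      · simp [ha]
      · simp [ha', hne.symm]
    · push Not at hin
      have : E ⊆ A ×ˢ B := by
        rintro ⟨x, y⟩ hp
        have h := Finset.mem_product.1 (hE hp)
        have h' := hin x y hp
        simp only [Finset.mem_product, Finset.mem_union] at h ⊢
        tauto
      simpa using Finset.card_le_card this

/-- The direction `e_b - e_a`. -/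
noncomputable def dirV {r : ℕ} (a b : Fin r) : Fin r → ℝ := Pi.single b 1 - Pi.single a 1

lemma convex_simpl {r : ℕ} (F : Finset (Fin r)) : Convex ℝ (simpl F) := by
  rintro x ⟨hx0, hxF, hx1⟩ y ⟨hy0, hyF, hy1⟩ s t hs ht hst
  refine ⟨fun i => ?_, fun i hi => ?_, ?_⟩
  · have := mul_nonneg hs (hx0 i)
    have := mul_nonneg ht (hy0 i)
    simp only [Pi.add_apply, Pi.smul_apply, smul_eq_mul]
    linarith
  · simp [hxF i hi, hyF i hi]
  · simp [Finset.sum_add_distrib, ← Finset.mul_sum, hx1, hy1, hst]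

lemma convex_mink {r k : ℕ} (F : Fin k → Finset (Fin r)) : Convex ℝ (mink F) :=
  convex_sum _ fun _ _ => convex_simpl _

lemma mem_mink {r k : ℕ} (F : Fin k → Finset (Fin r)) (u : Fin r → ℝ) :
    u ∈ mink F ↔ ∃ x : Fin k → Fin r → ℝ, (∀ j, x j ∈ simpl (F j)) ∧ ∑ j, x j = u := by
  unfold mink
  rw [Set.mem_fintype_sum]
  constructor
  · rintro ⟨g, hg, h⟩
    exact ⟨g, hg, h⟩
  · rintro ⟨g, hg, h⟩
    exact ⟨g, hg, h⟩

lemma exchange_mink {r k : ℕ} (F : Fin k → Finset (Fin r)) (x : Fin k → Fin r → ℝ)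
    (hx : ∀ j, x j ∈ simpl (F j)) (j : Fin k) (d : Fin r → ℝ) (hd : x j + d ∈ simpl (F j)) :
    ∑ j, x j + d ∈ mink F := by
  rw [mem_mink]
  refine ⟨x + Pi.single j d, fun i => ?_, ?_⟩
  · by_cases h : i = j
    · subst h
      simpa using hd
    · simpa [h] using hx i
  · simp [Finset.sum_add_distrib]

lemma simpl_move {r : ℕ} (F : Finset (Fin r)) (x : Fin r → ℝ) (hx : x ∈ simpl F) (a b : Fin r)
    (hab : a ≠ b) (hb : b ∈ F) (ε : ℝ) (hε : 0 ≤ ε) (h : ε ≤ x a) :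
    x + ε • dirV a b ∈ simpl F := by
  obtain ⟨hx0, hxF, hx1⟩ := hx
  refine ⟨fun i => ?_, fun i hi => ?_, ?_⟩
  · have := hx0 i
    simp only [dirV, Pi.add_apply, Pi.smul_apply, Pi.sub_apply, smul_eq_mul, Pi.single_apply]
    split_ifs with h1 h2 h2
    · simpa using this
    · simp; linarith
    · subst h2; simp; linarith
    · simpa using this
  · have h1 : i ≠ b := by rintro rfl; exact hi hb
    have h0 := hxF i hi
    simp only [dirV, Pi.add_apply, Pi.smul_apply, Pi.sub_apply, smul_eq_mul, Pi.single_apply, h1,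
      if_false, h0]
    split_ifs with h2
    · subst h2
      have : ε = 0 := by linarith
      simp [this]
    · simp
  · simp [dirV, Finset.sum_add_distrib, ← Finset.mul_sum, hx1]

lemma mid_mem_openSegment {r : ℕ} (u d : Fin r → ℝ) (v w : Fin r → ℝ) (h : v + w = u + u) :
    u ∈ openSegment ℝ v w := by
  refine ⟨1/2, 1/2, by norm_num, by norm_num, by norm_num, ?_⟩
  rw [← smul_add, h]
  ext i
  simp
  ring

lemma edge_dir {r k : ℕ} (F : Fin k → Finset (Fin r)) (u v : Fin r → ℝ)
    (h : IsEdgeOf (mink F) u v) : ∃ a b : Fin r, a ≠ b ∧ ∃ t : ℝ, 0 < t ∧ v = u + t • dirV a b := by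
  obtain ⟨hne, hu, hv, hext⟩ := h
  obtain ⟨x, hx, hxu⟩ := (mem_mink F u).1 hu.1
  obtain ⟨y, hy, hyv⟩ := (mem_mink F v).1 hv.1
  have hj : ∃ j, x j ≠ y j := by
    by_contra hcon
    push Not at hcon
    exact hne (by rw [← hxu, ← hyv]; simp [hcon])
  obtain ⟨j, hj⟩ := hj
  have hsum : ∑ i, x j i = ∑ i, y j i := by rw [(hx j).2.2, (hy j).2.2]
  have hex : ∃ i, x j i ≠ y j i := by
    by_contra hcon
    push Not at hcon
    exact hj (funext hcon)
  have ha : ∃ a, y j a < x j a := by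
    by_contra hcon
    push Not at hcon
    obtain ⟨i, hi⟩ := hex
    have := Finset.sum_lt_sum (s := Finset.univ) (f := x j) (g := y j) (fun i _ => hcon i)
      ⟨i, Finset.mem_univ _, lt_of_le_of_ne (hcon i) hi⟩
    linarith
  have hb : ∃ b, x j b < y j b := by
    by_contra hcon
    push Not at hcon
    obtain ⟨i, hi⟩ := hex
    have := Finset.sum_lt_sum (s := Finset.univ) (f := y j) (g := x j) (fun i _ => hcon i)
      ⟨i, Finset.mem_univ _, lt_of_le_of_ne (hcon i) hi.symm⟩
    linarith
  obtain ⟨a, ha⟩ := ha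
  obtain ⟨b, hb⟩ := hb
  have hab : a ≠ b := by rintro rfl; linarith
  have hxa : 0 < x j a := lt_of_le_of_lt ((hy j).1 a) ha
  have hyb : 0 < y j b := lt_of_le_of_lt ((hx j).1 b) hb
  have haF : a ∈ F j := by
    by_contra hcon
    have := (hx j).2.1 a hcon
    linarith
  have hbF : b ∈ F j := by
    by_contra hcon
    have := (hy j).2.1 b hcon
    linarith
  obtain ⟨ε, hε, hεx, hεy⟩ : ∃ ε : ℝ, 0 < ε ∧ ε ≤ x j a ∧ ε ≤ y j b :=
    ⟨min (x j a) (y j b), lt_min hxa hyb, min_le_left _ _, min_le_right _ _⟩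
  have m1 := exchange_mink F x hx j _ (simpl_move (F j) (x j) (hx j) a b hab hbF ε hε.le hεx)
  have m2 := exchange_mink F y hy j _ (simpl_move (F j) (y j) (hy j) b a hab.symm haF ε hε.le hεy)
  rw [hxu] at m1
  rw [hyv] at m2
  have hmid : (1/2 : ℝ) • u + (1/2 : ℝ) • v ∈ segment ℝ u v :=
    ⟨1/2, 1/2, by norm_num, by norm_num, by norm_num, rfl⟩
  have hseg := hext.left_mem_of_mem_openSegment m1 m2 hmid (by
    apply mid_mem_openSegment _ 0
    ext i
    simp [dirV]
    ring)
  obtain ⟨s, t, hs, ht, hst, heq⟩ := hseg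
  have hs' : s = 1 - t := by linarith
  have key : t • (v - u) = ε • dirV a b := by
    ext i
    have := congrFun heq i
    simp only [Pi.add_apply, Pi.smul_apply, Pi.sub_apply, smul_eq_mul, hs'] at this ⊢
    linarith
  have ht0 : t ≠ 0 := by
    rintro rfl
    have := congrFun key b
    simp [dirV, hab.symm] at this
    linarith
  have htp : 0 < t := lt_of_le_of_ne ht ht0.symm
  refine ⟨a, b, hab, ε / t, div_pos hε htp, ?_⟩
  have : v - u = (ε / t) • dirV a b := by
    rw [div_eq_inv_mul, mul_smul, ← key, smul_smul, inv_mul_cancel₀ ht0, one_smul]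
  rw [← this]
  abel

lemma support_card {r k : ℕ} (F : Fin k → Finset (Fin r)) (u : Fin r → ℝ)
    (hu : u ∈ Set.extremePoints ℝ (mink F)) :
    (Finset.univ.filter (fun a => u a ≠ 0)).card ≤ k := by
  obtain ⟨x, hx, hxu⟩ := (mem_mink F u).1 hu.1
  have huniq : ∀ j a b, x j a ≠ 0 → x j b ≠ 0 → a = b := by
    intro j a b ha hb
    by_contra hab
    have haF : a ∈ F j := by
      by_contra hcon
      exact ha ((hx j).2.1 a hcon)
    have hbF : b ∈ F j := by
      by_contra hcon
      exact hb ((hx j).2.1 b hcon)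
    have hxa : 0 < x j a := lt_of_le_of_ne ((hx j).1 a) ha.symm
    have hxb : 0 < x j b := lt_of_le_of_ne ((hx j).1 b) hb.symm
    obtain ⟨ε, hε, hεx, hεy⟩ : ∃ ε : ℝ, 0 < ε ∧ ε ≤ x j a ∧ ε ≤ x j b :=
      ⟨min (x j a) (x j b), lt_min hxa hxb, min_le_left _ _, min_le_right _ _⟩
    have m1 := exchange_mink F x hx j _ (simpl_move (F j) (x j) (hx j) a b hab hbF ε hε.le hεx)
    have m2 := exchange_mink F x hx j _
      (simpl_move (F j) (x j) (hx j) b a (Ne.symm hab) haF ε hε.le hεy)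
    rw [hxu] at m1 m2
    have := hu.2 m1 m2 (by
      apply mid_mem_openSegment _ 0
      ext i
      simp [dirV]
      ring)
    have := congrFun this b
    simp [dirV, Ne.symm hab] at this
    linarith
  have hch : ∀ a ∈ Finset.univ.filter (fun a => u a ≠ 0), ∃ j, x j a ≠ 0 := by
    intro a ha
    by_contra hcon
    push Not at hcon
    apply (Finset.mem_filter.1 ha).2
    rw [← hxu]
    simp [hcon]
  rcases Finset.eq_empty_or_nonempty (Finset.univ.filter (fun a => u a ≠ 0)) with h0 | ⟨a₀, ha₀⟩
  · rw [h0]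
    simp
  have hne : Nonempty (Fin k) := ⟨(hch a₀ ha₀).choose⟩
  choose! g hg using hch
  have := Finset.card_le_card_of_injOn (t := (Finset.univ : Finset (Fin k))) g
    (fun _ _ => Finset.mem_coe.2 (Finset.mem_univ _)) (s := Finset.univ.filter (fun a => u a ≠ 0)) (by
      intro a ha b hb hab
      have h1 := hg a ha
      have h2 := hg b hb
      rw [hab] at h1
      exact huniq _ _ _ h1 h2)
  simpa using this

lemma shrink_mem {r : ℕ} {P : Set (Fin r → ℝ)} (hP : Convex ℝ P) {u d : Fin r → ℝ} (hu : u ∈ P)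
    {t : ℝ} (h : u + t • d ∈ P) {ε : ℝ} (hε : 0 < ε) (hεt : ε ≤ t) : u + ε • d ∈ P := by
  have ht : 0 < t := lt_of_lt_of_le hε hεt
  have h1 : ε / t ≤ 1 := (div_le_one ht).2 hεt
  have := hP hu h (a := 1 - ε / t) (b := ε / t) (by linarith) (by positivity) (by ring)
  convert this using 1
  ext i
  simp
  field_simp
  ring

/-- The feasible directions `e_b - e_a` at `u`. -/
def Feas {r : ℕ} (P : Set (Fin r → ℝ)) (u : Fin r → ℝ) (a b : Fin r) : Prop :=
  ∃ t : ℝ, 0 < t ∧ u + t • dirV a b ∈ P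

lemma feas_trans {r : ℕ} {P : Set (Fin r → ℝ)} (hP : Convex ℝ P) {u : Fin r → ℝ} (hu : u ∈ P)
    {a b c : Fin r} (h1 : Feas P u a b) (h2 : Feas P u b c) : Feas P u a c := by
  obtain ⟨t, ht, h1⟩ := h1
  obtain ⟨s, hs, h2⟩ := h2
  have m1 := shrink_mem hP hu h1 (lt_min ht hs) (min_le_left _ _)
  have m2 := shrink_mem hP hu h2 (lt_min ht hs) (min_le_right _ _)
  refine ⟨min t s / 2, half_pos (lt_min ht hs), ?_⟩
  have := hP m1 m2 (a := 1/2) (b := 1/2) (by norm_num) (by norm_num) (by norm_num)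
  convert this using 1
  ext i
  simp [dirV]
  ring

lemma feas_antisymm {r : ℕ} {P : Set (Fin r → ℝ)} (hP : Convex ℝ P) {u : Fin r → ℝ}
    (hu : u ∈ Set.extremePoints ℝ P)
    {a b : Fin r} (hab : a ≠ b) (h1 : Feas P u a b) (h2 : Feas P u b a) : False := by
  obtain ⟨t, ht, h1⟩ := h1
  obtain ⟨s, hs, h2⟩ := h2
  have hp := lt_min ht hs
  have m1 := shrink_mem hP hu.1 h1 hp (min_le_left _ _)
  have m2 := shrink_mem hP hu.1 h2 hp (min_le_right _ _)
  have := hu.2 m1 m2 (by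
    apply mid_mem_openSegment _ 0
    ext i
    simp [dirV]
    ring)
  have := congrFun this b
  simp only [dirV, Pi.add_apply, Pi.smul_apply, Pi.sub_apply, smul_eq_mul, Pi.single_apply,
    if_true, if_neg hab.symm] at this
  linarith

/-- The pairs `(a,b)` such that an edge at `u` has direction `e_b - e_a`. -/
def EdgeDir {r : ℕ} (P : Set (Fin r → ℝ)) (u : Fin r → ℝ) (a b : Fin r) : Prop :=
  a ≠ b ∧ ∃ t : ℝ, 0 < t ∧ IsEdgeOf P u (u + t • dirV a b)

lemma EdgeDir.feas {r : ℕ} {P : Set (Fin r → ℝ)} {u : Fin r → ℝ} {a b : Fin r}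
    (h : EdgeDir P u a b) : Feas P u a b := by
  obtain ⟨_, t, ht, h⟩ := h
  exact ⟨t, ht, h.2.2.1.1⟩

lemma edgeDir_no_shortcut {r : ℕ} {P : Set (Fin r → ℝ)} (hP : Convex ℝ P) {u : Fin r → ℝ}
    (hu : u ∈ P) {a b c : Fin r} (hab : a ≠ b) (hbc : b ≠ c)
    (h1 : Feas P u a b) (h2 : Feas P u b c) (h3 : EdgeDir P u a c) : False := by
  obtain ⟨t, ht, h1⟩ := h1
  obtain ⟨s, hs, h2⟩ := h2
  obtain ⟨hac, q, hq, h3⟩ := h3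
  obtain ⟨ε, hε, e1, e2, e3⟩ : ∃ ε : ℝ, 0 < ε ∧ ε ≤ t ∧ ε ≤ s ∧ ε ≤ q :=
    ⟨min t (min s q), lt_min ht (lt_min hs hq), min_le_left _ _,
      (min_le_right _ _).trans (min_le_left _ _), (min_le_right _ _).trans (min_le_right _ _)⟩
  have m1 := shrink_mem hP hu h1 hε e1
  have m2 := shrink_mem hP hu h2 hε e2
  have m3 : u + (ε / 2) • dirV a c ∈ segment ℝ u (u + q • dirV a c) :=
    shrink_mem (convex_segment _ _) (left_mem_segment ℝ _ _) (right_mem_segment ℝ _ _)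
      (half_pos hε) (by linarith)
  obtain ⟨x, y, hx, hy, hxy, heq⟩ := h3.2.2.2.left_mem_of_mem_openSegment m1 m2 m3 (by
    apply mid_mem_openSegment _ 0
    ext i
    simp [dirV]
    ring)
  have := congrFun heq b
  have hx' : x = 1 - y := by linarith
  simp only [dirV, Pi.add_apply, Pi.smul_apply, Pi.sub_apply, smul_eq_mul, Pi.single_apply,
    if_true, if_neg hab.symm, if_neg hbc, hx'] at this
  linarith

lemma ray_unique {r : ℕ} {P : Set (Fin r → ℝ)} {u d : Fin r → ℝ} (hu : u ∈ P) {s t : ℝ}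
    (hs : 0 < s) (hst : s < t) (h1 : u + s • d ∈ Set.extremePoints ℝ P) (h2 : u + t • d ∈ P)
    (hne : u ≠ u + s • d) : False := by
  have ht : 0 < t := hs.trans hst
  have h : s / t < 1 := (div_lt_one ht).2 hst
  refine hne (h1.2 hu h2 ⟨1 - s / t, s / t, by linarith, by positivity, by ring, ?_⟩)
  ext i
  simp
  field_simp
  ring

/-- For a family of at most `k` nonempty subsets of `[r]`, where `1 ≤ k ≤ r/2`, every
vertex of `P_𝓕` has degree at most `k(r − k)`. -/
theorem degree_le_k_mul_r_sub_k {r k : ℕ} (hk1 : 1 ≤ k) (hk2 : 2 * k ≤ r)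
    (k' : ℕ) (hk' : k' ≤ k) (F : Fin k' → Finset (Fin r))
    (hF : ∀ j, (F j).Nonempty) (u : Fin r → ℝ)
    (hu : u ∈ Set.extremePoints ℝ (mink F)) :
    polyDeg (mink F) u ≤ k * (r - k) := by
  classical
  have hP := convex_mink F
  set P := mink F with hPdef
  set A : Finset (Fin r) := Finset.univ.filter (fun a => u a ≠ 0) with hA
  set E : Finset (Fin r × Fin r) := Finset.univ.filter (fun p => EdgeDir P u p.1 p.2) with hE
  have hmem : ∀ x y, (x, y) ∈ E ↔ EdgeDir P u x y := by intro x y; simp [hE]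
  have hAk : A.card ≤ k := (support_card F u hu).trans hk'
  have hBc : Aᶜ.card = r - A.card := by rw [Finset.card_compl, Fintype.card_fin]
  have hcount : E.card ≤ A.card * Aᶜ.card := by
    refine edges_le_mul Aᶜ A.card A E le_rfl disjoint_compl_right (by omega) ?_ ?_ ?_ ?_
    · rintro ⟨a, b⟩ hab
      rw [hmem] at hab
      have hne := hab.1
      obtain ⟨t, ht, hf⟩ := hab.feas
      simp only [Finset.mem_product, Finset.union_compl, Finset.mem_univ, and_true]
      rw [hA, Finset.mem_filter]
      refine ⟨Finset.mem_univ _, fun h0 => ?_⟩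
      obtain ⟨x, hx, hxu⟩ := (mem_mink F _).1 hf
      have h1 := congrFun hxu a
      have h2 : 0 ≤ ∑ j, x j a := Finset.sum_nonneg fun j _ => (hx j).1 a
      rw [Finset.sum_apply] at h1
      rw [h1] at h2
      simp only [dirV, Pi.add_apply, Pi.smul_apply, Pi.sub_apply, smul_eq_mul, Pi.single_apply,
        if_true, if_neg hne, h0] at h2
      linarith
    · intro x y hxy hyx
      rw [hmem] at hxy hyx
      exact feas_antisymm hP hu hxy.1 hxy.feas hyx.feas
    · intro x y z hxy hyz hxz
      rw [hmem] at hxy hyz hxz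
      exact edgeDir_no_shortcut hP hu.1 hxy.1 hyz.1 hxy.feas hyz.feas hxz
    · intro x y z hxy hyz hzx
      rw [hmem] at hxy hyz hzx
      exact feas_antisymm hP hu hzx.1.symm (feas_trans hP hu.1 hxy.feas hyz.feas) hzx.feas
  have hdeg : polyDeg P u ≤ E.card := by
    unfold polyDeg
    have hch : ∀ v ∈ {v | IsEdgeOf P u v}, ∃ p : Fin r × Fin r, p.1 ≠ p.2 ∧
        ∃ t : ℝ, 0 < t ∧ v = u + t • dirV p.1 p.2 := by
      intro v hv
      obtain ⟨a, b, h⟩ := edge_dir F u v hv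
      exact ⟨(a, b), h⟩
    have hr : Nonempty (Fin r × Fin r) := ⟨(⟨0, by omega⟩, ⟨0, by omega⟩)⟩
    choose! g hg using hch
    rw [← Set.ncard_coe_finset]
    refine Set.ncard_le_ncard_of_injOn g ?_ ?_ (Finset.finite_toSet _)
    · intro v hv
      obtain ⟨h1, t, ht, h2⟩ := hg v hv
      rw [Finset.mem_coe, hmem (g v).1 (g v).2]
      refine ⟨h1, t, ht, ?_⟩
      rw [← h2]
      exact hv
    · intro v hv w hw hvw
      obtain ⟨h1, t, ht, h2⟩ := hg v hv
      obtain ⟨h1', s, hs, h2'⟩ := hg w hw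
      rw [← hvw] at h2'
      have hv' : IsEdgeOf P u v := hv
      have hw' : IsEdgeOf P u w := hw
      rw [h2] at hv'
      rw [h2'] at hw'
      rcases lt_trichotomy s t with h | h | h
      · exact (ray_unique hu.1 hs h hw'.2.2.1 hv'.2.2.1.1 hw'.1).elim
      · rw [h2, h2', h]
      · exact (ray_unique hu.1 ht h hv'.2.2.1 hw'.2.2.1.1 hv'.1).elim
  refine hdeg.trans (hcount.trans ?_)
  rw [hBc]
  obtain ⟨d, hd⟩ := Nat.exists_eq_add_of_le hAk
  obtain ⟨e, he⟩ := Nat.exists_eq_add_of_le hk2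
  have e1 : r - A.card = A.card + 2 * d + e := by omega
  have e2 : r - k = k + e := by omega
  rw [e1, e2, hd]
  nlinarith [Nat.zero_le (d * d), Nat.zero_le (d * e)]
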